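/- Let H be a finite-dimensional complex Hilbert space, q_1,…,q_n a finite list of questions, A a finite answer set, and for each question q_i let {W_{q_i}^a}_{a∈A} be a projective measurement on H. Let ψ ∈ H ⊗ H be a unit vector invariant under swapping the two tensor factors. Define D(a_1,…,a_n) = ‖(W_{q_n}^{a_n}⋯W_{q_1}^{a_1} ⊗ Id)ψ‖², let p_class(a, a' | q_i, q_j) be the marginal of D on coordinates (i, j), and let p_q(a, a' | q_i, q_j) = ‖(W_{q_i}^{a} ⊗ W_{q_j}^{a'})ψ‖². Then for every pair of indices i > j, Σ_{a_i, a_j} | p_class(a_i, a_j | q_i, q_j) − p_q(a_i, a_j | q_i, q_j) | ≤ 2 Σ_{i'=1}^{i−1} √( Σ_{a} ‖(W_{q_{i'}}^{a} ⊗ Id − Id ⊗ W_{q_{i'}}^{a})ψ‖² ) + 2(|i − j| + 1) √( Σ_{a} ‖(Id ⊗ W_{q_i}^{a} − W_{q_i}^{a} ⊗ Id)ψ‖² ) + 2 Σ_{i'=j+1}^{i−1} √( Σ_{a, a'} ‖(W_{q_i}^{a} ⊗ W_{q_{i'}}^{a'} − W_{q_{i'}}^{a'} ⊗ W_{q_i}^{a})ψ‖²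 ). -/

import Mathlib

open scoped Kronecker

/-- Squared ℓ²-norm of a vector in a finite-dimensional complex Hilbert space. -/
noncomputable def nsq {ι : Type*} [Fintype ι] (v : ι → ℂ) : ℝ := ∑ i, ‖v i‖ ^ 2

/-- A projective measurement with outcome set `A`: a family of orthogonal projections
summing to the identity. -/
def IsProjMeas {n : Type*} [Fintype n] [DecidableEq n] {A : Type*} [Fintype A]
    (W : A → Matrix n n ℂ) : Prop :=
  (∀ a, (W a).IsHermitian) ∧ (∀ a, W a * W a = W a) ∧ (∑ a, W a) = 1

/-- The ordered product `W_{q_n}^{a_n} ⋯ W_{q_1}^{a_1}` (indices decreasing from left to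
right) of the projectors chosen by the answer tuple `f`. -/
noncomputable def descProd {d n : ℕ} {A : Type*}
    (W : Fin n → A → Matrix (Fin d) (Fin d) ℂ) (f : Fin n → A) :
    Matrix (Fin d) (Fin d) ℂ :=
  (((List.finRange n).reverse.map fun l => W l (f l)).prod)

section QuestionOrder

open Matrix Function

section SquaredNorm

variable {ι κ : Type*} [Fintype ι] [Fintype κ]

@[simp] theorem nsq_zero : nsq (0 : ι → ℂ) = 0 := by simp [nsq]

theorem nsq_sub_comm (u v : ι → ℂ) : nsq (u - v) = nsq (v - u) := by
  simp [nsq, norm_sub_rev]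

theorem sqrt_nsq_eq_norm (v : ι → ℂ) : √(nsq v) = ‖WithLp.toLp 2 v‖ := by
  rw [EuclideanSpace.norm_eq]; rfl

theorem sqrt_nsq_sub_le (u v w : ι → ℂ) :
    √(nsq (u - w)) ≤ √(nsq (u - v)) + √(nsq (v - w)) := by
  simp only [sqrt_nsq_eq_norm, WithLp.toLp_sub]
  exact norm_sub_le_norm_sub_add_norm_sub _ _ _

theorem nsq_prod (v : ι × κ → ℂ) : nsq v = ∑ i, nsq fun k => v (i, k) := by
  simp [nsq, Fintype.sum_prod_type]

theorem ofReal_nsq (v : ι → ℂ) : (nsq v : ℂ) = star v ⬝ᵥ v := by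
  simp only [nsq, dotProduct, Pi.star_apply, RCLike.star_def, Complex.conj_mul']
  push_cast
  rfl

theorem sum_abs_normSq_sub_le (u v : ι → ℂ) (hu : nsq u = 1) (hv : nsq v = 1) :
    ∑ x, |‖u x‖ ^ 2 - ‖v x‖ ^ 2| ≤ 2 * √(nsq (u - v)) := by
  have hterm (x : ι) : |‖u x‖ ^ 2 - ‖v x‖ ^ 2| ≤
      ‖(u - v) x‖ * ‖u x‖ + ‖(u - v) x‖ * ‖v x‖ := by
    rw [sq_sub_sq, abs_mul, abs_of_nonneg (by positivity), ← mul_add, mul_comm]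
    exact mul_le_mul_of_nonneg_right (abs_norm_sub_norm_le _ _) (by positivity)
  have hcs (w : ι → ℂ) (hw : nsq w = 1) :
      ∑ x, ‖(u - v) x‖ * ‖w x‖ ≤ √(nsq (u - v)) := by
    have h := Real.sum_mul_le_sqrt_mul_sqrt Finset.univ (fun x => ‖(u - v) x‖) (fun x => ‖w x‖)
    change _ ≤ √(nsq (u - v)) * √(nsq w) at h
    simpa [hw] using h
  calc _ ≤ ∑ x, (‖(u - v) x‖ * ‖u x‖ + ‖(u - v) x‖ * ‖v x‖) :=
        Finset.sum_le_sum fun x _ => hterm x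
    _ ≤ _ := by
        rw [Finset.sum_add_distrib, two_mul]
        exact add_le_add (hcs u hu) (hcs v hv)

theorem sum_abs_nsq_sub_le (u v : ι × κ → ℂ) (hu : nsq u = 1) (hv : nsq v = 1) :
    ∑ i, |nsq (fun k => u (i, k)) - nsq (fun k => v (i, k))| ≤ 2 * √(nsq (u - v)) := by
  refine le_trans (Finset.sum_le_sum fun i _ => ?_)
    ((Fintype.sum_prod_type _).symm.le.trans (sum_abs_normSq_sub_le u v hu hv))
  simp only [nsq, ← Finset.sum_sub_distrib]
  exact Finset.abs_sum_le_sum_abs _ _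

end SquaredNorm

section ProjectiveMeasurement

variable {ι κ A : Type*} [Fintype ι] [DecidableEq ι] [Fintype κ] [DecidableEq κ] [Fintype A]

theorem IsProjMeas.sum_nsq_mulVec {W : A → Matrix ι ι ℂ} (hW : IsProjMeas W) (v : ι → ℂ) :
    ∑ a, nsq (W a *ᵥ v) = nsq v := by
  obtain ⟨hherm, hproj, hsum⟩ := hW
  have key (a : A) : (nsq (W a *ᵥ v) : ℂ) = star v ⬝ᵥ (W a *ᵥ v) := by
    rw [ofReal_nsq, star_mulVec, (hherm a).eq, ← dotProduct_mulVec, mulVec_mulVec, hproj]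
  have : ((∑ a, nsq (W a *ᵥ v) : ℝ) : ℂ) = (nsq v : ℂ) := by
    push_cast
    simp_rw [key]
    rw [← dotProduct_sum, ← sum_mulVec, hsum, one_mulVec, ofReal_nsq]
  exact_mod_cast this

theorem IsProjMeas.kronecker_one {W : A → Matrix ι ι ℂ} (hW : IsProjMeas W) :
    IsProjMeas fun a => W a ⊗ₖ (1 : Matrix κ κ ℂ) := by
  obtain ⟨hherm, hproj, hsum⟩ := hW
  refine ⟨fun a => ?_, fun a => ?_, ?_⟩
  · rw [IsHermitian, conjTranspose_kronecker, (hherm a).eq, conjTranspose_one]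
  · rw [← mul_kronecker_mul, hproj, one_mul]
  · ext x y
    simp only [Matrix.sum_apply, kroneckerMap_apply, ← Finset.sum_mul]
    rw [← Matrix.sum_apply, hsum, ← kroneckerMap_apply (· * ·), one_kronecker_one]

theorem IsProjMeas.one_kronecker {W : A → Matrix ι ι ℂ} (hW : IsProjMeas W) :
    IsProjMeas fun a => (1 : Matrix κ κ ℂ) ⊗ₖ W a := by
  obtain ⟨hherm, hproj, hsum⟩ := hW
  refine ⟨fun a => ?_, fun a => ?_, ?_⟩
  · rw [IsHermitian, conjTranspose_kronecker, (hherm a).eq, conjTranspose_one]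
  · rw [← mul_kronecker_mul, hproj, one_mul]
  · ext x y
    simp only [Matrix.sum_apply, kroneckerMap_apply, ← Finset.mul_sum]
    rw [← Matrix.sum_apply, hsum, ← kroneckerMap_apply (· * ·), one_kronecker_one]

end ProjectiveMeasurement

section Resampling

variable {ι κ A : Type*} [Fintype ι] [DecidableEq ι] [Fintype A]

theorem sum_sum_update (l : ι) (G : (ι → A) → ℝ) :
    ∑ f, ∑ b, G (update f l b) = Fintype.card A * ∑ f, G f := by
  have hinv : Involutive fun p : (ι → A) × A => (update p.1 l p.2, p.1 l) := by
    rintro ⟨f, b⟩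
    simp
  have h := Equiv.sum_comp hinv.toPerm fun p : (ι → A) × A => G p.1
  simpa [Fintype.sum_prod_type, Finset.mul_sum] using h

theorem card_mul_sum_nsq_mulVec [Fintype κ] [DecidableEq κ] (l : ι) {P : A → Matrix κ κ ℂ}
    (hP : IsProjMeas P) (φ : (ι → A) → κ → ℂ) (hφ : ∀ f b, φ (update f l b) = φ f) :
    Fintype.card A * ∑ f, nsq (P (f l) *ᵥ φ f) = ∑ f, nsq (φ f) := by
  rw [← sum_sum_update l]
  simp [hφ, hP.sum_nsq_mulVec]

theorem card_mul_sum_apply (l : ι) (g : A → ℝ) :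
    Fintype.card A * ∑ f : ι → A, g (f l) =
      (Fintype.card A : ℝ) ^ Fintype.card ι * ∑ b, g b := by
  rw [← sum_sum_update l]
  simp

theorem card_sq_mul_sum_apply {k l : ι} (hkl : k ≠ l) (h : A → A → ℝ) :
    (Fintype.card A : ℝ) ^ 2 * ∑ f : ι → A, h (f k) (f l) =
      (Fintype.card A : ℝ) ^ Fintype.card ι * ∑ a, ∑ b, h a b := by
  rw [sq, mul_assoc, ← sum_sum_update l]
  simp only [update_self, update_of_ne hkl]
  exact card_mul_sum_apply k fun a => ∑ b, h a b

end Resampling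

section MeasuredVectors

variable {d n : ℕ} {A : Type*} (W : Fin n → A → Matrix (Fin d) (Fin d) ℂ)

/-- The product, in the order of `L`, of the projectors chosen by `f`. -/
noncomputable def prodAlong (L : List (Fin n)) (f : Fin n → A) : Matrix (Fin d) (Fin d) ℂ :=
  (L.map fun l => W l (f l)).prod

@[simp] theorem prodAlong_nil (f : Fin n → A) : prodAlong W [] f = 1 := rfl

@[simp] theorem prodAlong_cons (l : Fin n) (L : List (Fin n)) (f : Fin n → A) :
    prodAlong W (l :: L) f = W l (f l) * prodAlong W L f := by
  simp [prodAlong]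

@[simp] theorem prodAlong_append (L L' : List (Fin n)) (f : Fin n → A) :
    prodAlong W (L ++ L') f = prodAlong W L f * prodAlong W L' f := by
  simp [prodAlong]

theorem prodAlong_update {l : Fin n} {L : List (Fin n)} (hl : l ∉ L) (f : Fin n → A) (b : A) :
    prodAlong W L (update f l b) = prodAlong W L f := by
  unfold prodAlong
  congr 1
  refine List.map_congr_left fun k hk => ?_
  rw [update_of_ne (ne_of_mem_of_not_mem hk hl)]

/-- The family of vectors obtained from `ψ` by applying the projectors of `L` to the first
factor and those of `R` to the second one, for all answer tuples at once. -/
noncomputable def measured (ψ : Fin d × Fin d → ℂ) (L R : List (Fin n)) :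
    (Fin n → A) × (Fin d × Fin d) → ℂ :=
  fun p => ((prodAlong W L p.1 ⊗ₖ prodAlong W R p.1) *ᵥ ψ) p.2

variable [Fintype A] {W}

theorem card_pow_mul_sum_nsq (hW : ∀ i, IsProjMeas (W i)) (L R : List (Fin n))
    (hLR : (L ++ R).Nodup) (φ : (Fin n → A) → Fin d × Fin d → ℂ)
    (hφ : ∀ l ∈ L ++ R, ∀ f b, φ (update f l b) = φ f) :
    (Fintype.card A : ℝ) ^ (L ++ R).length *
        ∑ f, nsq ((prodAlong W L f ⊗ₖ prodAlong W R f) *ᵥ φ f) = ∑ f, nsq (φ f) := by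
  induction L with
  | nil =>
    induction R with
    | nil => simp
    | cons l R ih =>
      simp only [List.nil_append, List.nodup_cons, List.mem_cons, forall_eq_or_imp] at hLR hφ ih
      have hfac (f : Fin n → A) : (prodAlong W [] f ⊗ₖ prodAlong W (l :: R) f) *ᵥ φ f =
          ((1 : Matrix (Fin d) (Fin d) ℂ) ⊗ₖ W l (f l)) *ᵥ
            ((prodAlong W [] f ⊗ₖ prodAlong W R f) *ᵥ φ f) := by
        rw [mulVec_mulVec, ← mul_kronecker_mul]
        simp
      simp_rw [hfac]
      rw [List.nil_append, List.length_cons, pow_succ, mul_assoc,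
        card_mul_sum_nsq_mulVec l (hW l).one_kronecker, ih hLR.2 hφ.2]
      intro f b
      rw [hφ.1, prodAlong_update W hLR.1]
      rfl
  | cons l L ih =>
    simp only [List.cons_append, List.nodup_cons, List.mem_cons, forall_eq_or_imp] at hLR hφ
    have hfac (f : Fin n → A) : (prodAlong W (l :: L) f ⊗ₖ prodAlong W R f) *ᵥ φ f =
        (W l (f l) ⊗ₖ (1 : Matrix (Fin d) (Fin d) ℂ)) *ᵥ
          ((prodAlong W L f ⊗ₖ prodAlong W R f) *ᵥ φ f) := by
      rw [mulVec_mulVec, ← mul_kronecker_mul]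
      simp
    simp_rw [hfac]
    rw [List.cons_append, List.length_cons, pow_succ, mul_assoc,
      card_mul_sum_nsq_mulVec l (hW l).kronecker_one, ih hLR.2 hφ.2]
    intro f b
    have hl := hLR.1
    rw [List.mem_append, not_or] at hl
    rw [hφ.1, prodAlong_update W hl.1, prodAlong_update W hl.2]

variable [Nonempty A]

theorem nsq_measured (hW : ∀ i, IsProjMeas (W i)) (ψ : Fin d × Fin d → ℂ)
    {L R : List (Fin n)} (hLR : (L ++ R).Nodup) (hlen : (L ++ R).length = n) :
    nsq (measured W ψ L R) = nsq ψ := by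
  have h := card_pow_mul_sum_nsq hW L R hLR (fun _ => ψ) (by simp)
  rw [nsq_prod]
  simp only [hlen, Finset.sum_const, Finset.card_univ, Fintype.card_pi, Finset.prod_const,
    Fintype.card_fin, nsmul_eq_mul, Nat.cast_pow] at h
  exact mul_left_cancel₀ (by positivity) h

theorem sum_nsq_prodAlong_apply (hW : ∀ i, IsProjMeas (W i)) {L R : List (Fin n)} {l : Fin n}
    (hLR : (l :: (L ++ R)).Nodup) (hlen : (l :: (L ++ R)).length = n)
    (g : A → Fin d × Fin d → ℂ) :
    ∑ f, nsq ((prodAlong W L f ⊗ₖ prodAlong W R f) *ᵥ g (f l)) = ∑ b, nsq (g b) := by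
  rw [List.nodup_cons] at hLR
  have h := card_pow_mul_sum_nsq hW L R hLR.2 (fun f => g (f l)) fun k hk f b => by
    rw [update_of_ne (ne_of_mem_of_not_mem hk hLR.1).symm]
  have h' := card_mul_sum_apply l fun b => nsq (g b)
  rw [Fintype.card_fin, ← h, ← mul_assoc, ← pow_succ', ← List.length_cons, hlen] at h'
  exact mul_left_cancel₀ (by positivity) h'

theorem sum_nsq_prodAlong_apply₂ (hW : ∀ i, IsProjMeas (W i)) {L R : List (Fin n)}
    {k l : Fin n} (hLR : (k :: l :: (L ++ R)).Nodup) (hlen : (k :: l :: (L ++ R)).length = n)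
    (h : A → A → Fin d × Fin d → ℂ) :
    ∑ f, nsq ((prodAlong W L f ⊗ₖ prodAlong W R f) *ᵥ h (f k) (f l)) =
      ∑ a, ∑ b, nsq (h a b) := by
  simp only [List.nodup_cons, List.mem_cons, not_or] at hLR
  have h₁ := card_pow_mul_sum_nsq hW L R hLR.2.2 (fun f => h (f k) (f l)) fun m hm f b => by
    rw [update_of_ne (ne_of_mem_of_not_mem hm hLR.1.2).symm,
      update_of_ne (ne_of_mem_of_not_mem hm hLR.2.1).symm]
  have h₂ := card_sq_mul_sum_apply hLR.1.1 fun a b => nsq (h a b)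
  have hlen' : 2 + (L ++ R).length = n := by
    simp only [List.length_cons] at hlen
    omega
  rw [Fintype.card_fin, ← h₁, ← mul_assoc, ← pow_add, hlen'] at h₂
  exact mul_left_cancel₀ (by positivity) h₂

/-- How far a measurement is from acting identically on the two factors of `ψ`. -/
noncomputable def transferErr (ψ : Fin d × Fin d → ℂ) (P : A → Matrix (Fin d) (Fin d) ℂ) : ℝ :=
  √(∑ b, nsq ((P b ⊗ₖ (1 : Matrix (Fin d) (Fin d) ℂ)
    - (1 : Matrix (Fin d) (Fin d) ℂ) ⊗ₖ P b) *ᵥ ψ))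

/-- How far two measurements are from being exchangeable between the two factors of `ψ`. -/
noncomputable def exchangeErr (ψ : Fin d × Fin d → ℂ)
    (P Q : A → Matrix (Fin d) (Fin d) ℂ) : ℝ :=
  √(∑ b, ∑ b', nsq ((P b ⊗ₖ Q b' - Q b' ⊗ₖ P b) *ᵥ ψ))

theorem sqrt_nsq_transfer (hW : ∀ i, IsProjMeas (W i)) (ψ : Fin d × Fin d → ℂ)
    {L R : List (Fin n)} {l : Fin n} (hLR : (l :: (L ++ R)).Nodup)
    (hlen : (l :: (L ++ R)).length = n) :
    √(nsq (measured W ψ (L ++ [l]) R - measured W ψ L (R ++ [l]))) = transferErr ψ (W l) := by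
  rw [transferErr, nsq_prod, ← sum_nsq_prodAlong_apply hW hLR hlen]
  congr! 3 with f
  ext x
  simp [measured, sub_mulVec, mulVec_sub, mulVec_mulVec, ← mul_kronecker_mul]

theorem sqrt_nsq_exchange (hW : ∀ i, IsProjMeas (W i)) (ψ : Fin d × Fin d → ℂ)
    {L R : List (Fin n)} {k l : Fin n} (hLR : (k :: l :: (L ++ R)).Nodup)
    (hlen : (k :: l :: (L ++ R)).length = n) :
    √(nsq (measured W ψ (L ++ [k]) (R ++ [l]) - measured W ψ (L ++ [l]) (R ++ [k]))) =
      exchangeErr ψ (W k) (W l) := by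
  rw [exchangeErr, nsq_prod, ← sum_nsq_prodAlong_apply₂ hW hLR hlen]
  congr! 3 with f
  ext x
  simp [measured, sub_mulVec, mulVec_sub, mulVec_mulVec, ← mul_kronecker_mul]

theorem sqrt_nsq_transfer_list_le (hW : ∀ i, IsProjMeas (W i)) (ψ : Fin d × Fin d → ℂ)
    (L m R : List (Fin n)) (hLR : (L ++ m ++ R).Nodup) (hlen : (L ++ m ++ R).length = n) :
    √(nsq (measured W ψ (L ++ m.reverse) R - measured W ψ L (R ++ m))) ≤
      (m.map fun l => transferErr ψ (W l)).sum := by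
  induction m generalizing R with
  | nil => simp
  | cons l m ih =>
    have hp : (l :: (L ++ m.reverse ++ R)).Perm (L ++ (l :: m) ++ R) := by
      simp only [List.append_assoc, List.cons_append]
      exact (List.perm_middle.trans
        (((m.reverse_perm.append_right R).append_left L).cons l).symm).symm
    have hp' : (L ++ m ++ (R ++ [l])).Perm (L ++ (l :: m) ++ R) := by
      refine List.perm_iff_count.2 fun x => ?_
      simp only [List.count_append, List.count_cons, List.count_nil]
      ring
    have h₁ := sqrt_nsq_transfer hW ψ (hp.nodup_iff.2 hLR) (hp.length_eq.trans hlen)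
    have h₂ := ih (R ++ [l]) (hp'.nodup_iff.2 hLR) (hp'.length_eq.trans hlen)
    have h₃ := sqrt_nsq_sub_le (measured W ψ (L ++ m.reverse ++ [l]) R)
      (measured W ψ (L ++ m.reverse) (R ++ [l])) (measured W ψ L (R ++ [l] ++ m))
    simp only [List.reverse_cons, List.map_cons, List.sum_cons, List.append_assoc,
      List.singleton_append] at h₁ h₂ h₃ ⊢
    linarith

theorem sqrt_nsq_commute_list_le (hW : ∀ i, IsProjMeas (W i)) (ψ : Fin d × Fin d → ℂ)
    (i : Fin n) (L R m : List (Fin n)) (hLR : (i :: (L ++ R ++ m)).Nodup)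
    (hlen : (i :: (L ++ R ++ m)).length = n) :
    √(nsq (measured W ψ (L ++ [i]) (R ++ m) - measured W ψ (L ++ m.reverse ++ [i]) R)) ≤
      (m.map fun l => exchangeErr ψ (W i) (W l) + transferErr ψ (W i)).sum := by
  induction m using List.reverseRecOn generalizing L with
  | nil => simp
  | append_singleton m l ih =>
    have hp : (i :: l :: (L ++ (R ++ m))).Perm (i :: (L ++ R ++ (m ++ [l]))) := by
      refine List.perm_iff_count.2 fun x => ?_
      simp only [List.count_append, List.count_cons, List.count_nil]
      ring
    have hp' : (i :: (L ++ [l] ++ (R ++ m))).Perm (i :: (L ++ R ++ (m ++ [l]))) := by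
      refine List.perm_iff_count.2 fun x => ?_
      simp only [List.count_append, List.count_cons, List.count_nil]
      ring
    have hp'' : (i :: (L ++ [l] ++ R ++ m)).Perm (i :: (L ++ R ++ (m ++ [l]))) := by
      refine List.perm_iff_count.2 fun x => ?_
      simp only [List.count_append, List.count_cons, List.count_nil]
      ring
    have h₁ := sqrt_nsq_exchange hW ψ (hp.nodup_iff.2 hLR) (hp.length_eq.trans hlen)
    have h₂ := sqrt_nsq_transfer hW ψ (hp'.nodup_iff.2 hLR) (hp'.length_eq.trans hlen)
    have h₃ := ih (L ++ [l]) (hp''.nodup_iff.2 hLR) (hp''.length_eq.trans hlen)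
    rw [nsq_sub_comm] at h₂
    have h₄ := sqrt_nsq_sub_le (measured W ψ (L ++ [i]) (R ++ m ++ [l]))
      (measured W ψ (L ++ [l]) (R ++ m ++ [i]))
      (measured W ψ (L ++ [l] ++ m.reverse ++ [i]) R)
    have h₅ := sqrt_nsq_sub_le (measured W ψ (L ++ [l]) (R ++ m ++ [i]))
      (measured W ψ (L ++ [l] ++ [i]) (R ++ m))
      (measured W ψ (L ++ [l] ++ m.reverse ++ [i]) R)
    simp only [List.reverse_append, List.reverse_cons, List.reverse_nil, List.nil_append,
      List.map_append, List.map_cons, List.map_nil, List.sum_append, List.sum_cons,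
      List.sum_nil, List.append_assoc, List.cons_append] at *
    linarith

theorem sum_ite_nsq_measured [DecidableEq A] (hW : ∀ i, IsProjMeas (W i))
    (ψ : Fin d × Fin d → ℂ) {L R : List (Fin n)} {k l : Fin n}
    (hLR : (k :: l :: (L ++ R)).Nodup) (hlen : (k :: l :: (L ++ R)).length = n) (a a' : A) :
    ∑ f : Fin n → A, (if f k = a ∧ f l = a' then
      nsq (fun x => measured W ψ (L ++ [k]) (R ++ [l]) (f, x)) else 0) =
      nsq ((W k a ⊗ₖ W l a') *ᵥ ψ) := by
  have h := sum_nsq_prodAlong_apply₂ hW hLR hlen fun b b' =>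
    if b = a ∧ b' = a' then (W k b ⊗ₖ W l b') *ᵥ ψ else 0
  have hsum : ∑ b, ∑ b', nsq (if b = a ∧ b' = a' then (W k b ⊗ₖ W l b') *ᵥ ψ else 0) =
      nsq ((W k a ⊗ₖ W l a') *ᵥ ψ) := by
    simp only [ite_and, apply_ite nsq, nsq_zero]
    simp
  rw [← hsum, ← h]
  refine Finset.sum_congr rfl fun f _ => ?_
  split_ifs
  · congr 1
    ext x
    simp [measured, mulVec_mulVec, ← mul_kronecker_mul]
  · simp

end MeasuredVectors

theorem exists_finRange_eq_append {n : ℕ} {i j : Fin n} (hij : j < i) :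
    ∃ pre mid post : List (Fin n), List.finRange n = (pre ++ [j] ++ mid) ++ i :: post ∧
      (pre ++ [j] ++ mid).toFinset = Finset.Iio i ∧ mid.toFinset = Finset.Ioo j i := by
  obtain ⟨s, post, hs⟩ := List.append_of_mem (List.mem_finRange i)
  have hsorted := List.pairwise_lt_finRange n
  have hmem := List.mem_finRange (n := n)
  rw [hs] at hsorted hmem
  simp only [List.pairwise_append, List.pairwise_cons, List.mem_append, List.mem_cons]
    at hsorted hmem
  have hs_iff (x : Fin n) : x ∈ s ↔ x < i := by grind
  obtain ⟨pre, mid, rfl⟩ := List.append_of_mem ((hs_iff j).2 hij)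
  have hs' := hsorted.1
  simp only [List.pairwise_append, List.pairwise_cons, List.mem_append, List.mem_cons]
    at hs' hs_iff
  refine ⟨pre, mid, post, by simpa using hs, ?_, ?_⟩
  · ext x
    simpa [or_left_comm] using hs_iff x
  · ext x
    simp only [List.mem_toFinset, Finset.mem_Ioo]
    grind

theorem sum_sum_abs_marginal_sub_le {ι A : Type*} [Fintype ι] [Fintype A] [DecidableEq A]
    (g h : ι → A) (u v : ι → ℝ) :
    ∑ a, ∑ a', |(∑ f, if g f = a ∧ h f = a' then u f else 0)
      - ∑ f, if g f = a ∧ h f = a' then v f else 0| ≤ ∑ f, |u f - v f| := by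
  have hle (a a' : A) : |(∑ f, if g f = a ∧ h f = a' then u f else 0)
      - ∑ f, if g f = a ∧ h f = a' then v f else 0| ≤
      ∑ f, if g f = a ∧ h f = a' then |u f - v f| else 0 := by
    rw [← Finset.sum_sub_distrib]
    refine (Finset.abs_sum_le_sum_abs _ _).trans (Finset.sum_le_sum fun f _ => ?_)
    split_ifs <;> simp
  refine (Finset.sum_le_sum fun a _ => Finset.sum_le_sum fun a' _ => hle a a').trans ?_
  simp_rw [Finset.sum_comm (s := Finset.univ (α := A)) (t := Finset.univ (α := ι))]
  simp [ite_and]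

end QuestionOrder

theorem stmt11 {d n : ℕ} {A : Type*} [Fintype A] [DecidableEq A]
    (W : Fin n → A → Matrix (Fin d) (Fin d) ℂ)
    (hW : ∀ i, IsProjMeas (W i))
    (ψ : Fin d × Fin d → ℂ)
    (hunit : nsq ψ = 1)
    (hsym : ∀ i j, ψ (i, j) = ψ (j, i))
    (i j : Fin n) (hij : j < i) :
    ∑ a : A, ∑ a' : A,
        |(∑ f : Fin n → A, if f i = a ∧ f j = a' then
            nsq ((descProd W f ⊗ₖ (1 : Matrix (Fin d) (Fin d) ℂ)).mulVec ψ) else 0)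
          - nsq ((W i a ⊗ₖ W j a').mulVec ψ)|
      ≤ 2 * (∑ i' ∈ Finset.Iio i, Real.sqrt (∑ b,
            nsq ((W i' b ⊗ₖ (1 : Matrix (Fin d) (Fin d) ℂ)
              - (1 : Matrix (Fin d) (Fin d) ℂ) ⊗ₖ W i' b).mulVec ψ)))
        + 2 * (((i : ℕ) - (j : ℕ) + 1 : ℕ) : ℝ) * Real.sqrt (∑ b,
            nsq (((1 : Matrix (Fin d) (Fin d) ℂ) ⊗ₖ W i b
              - W i b ⊗ₖ (1 : Matrix (Fin d) (Fin d) ℂ)).mulVec ψ))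
        + 2 * (∑ i' ∈ Finset.Ioo j i, Real.sqrt (∑ b, ∑ b',
            nsq ((W i b ⊗ₖ W i' b' - W i' b' ⊗ₖ W i b).mulVec ψ))) := by
  rcases isEmpty_or_nonempty A with hA | hA
  · simp
  obtain ⟨pre, mid, post, hfin, hIio, hIoo⟩ := exists_finRange_eq_append hij
  have hnd := List.nodup_finRange n
  have hlen := List.length_finRange (n := n)
  rw [hfin] at hnd hlen
  have hdesc : (List.finRange n).reverse =
      (post.reverse ++ [i]) ++ (pre ++ [j] ++ mid).reverse := by
    rw [hfin]
    simp
  have perm₁ : ((post.reverse ++ [i]) ++ (pre ++ [j] ++ mid) ++ []).Perm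
      ((pre ++ [j] ++ mid) ++ i :: post) := by
    refine List.perm_iff_count.2 fun x => ?_
    simp only [List.count_append, List.count_cons, List.count_reverse, List.count_nil]
    ring
  have perm₂ : (i :: (post.reverse ++ (pre ++ [j]) ++ mid)).Perm
      ((pre ++ [j] ++ mid) ++ i :: post) := by
    refine List.perm_iff_count.2 fun x => ?_
    simp only [List.count_append, List.count_cons, List.count_reverse, List.count_nil]
    ring
  have perm₃ : (i :: j :: ((post.reverse ++ mid.reverse) ++ pre)).Perm
      ((pre ++ [j] ++ mid) ++ i :: post) := by
    refine List.perm_iff_count.2 fun x => ?_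
    simp only [List.count_append, List.count_cons, List.count_reverse, List.count_nil]
    ring
  have perm₄ : ((post.reverse ++ mid.reverse ++ [i]) ++ (pre ++ [j])).Perm
      ((pre ++ [j] ++ mid) ++ i :: post) := by
    refine List.perm_iff_count.2 fun x => ?_
    simp only [List.count_append, List.count_cons, List.count_reverse, List.count_nil]
    ring
  have perm₅ : ((post.reverse ++ [i]) ++ (pre ++ [j] ++ mid).reverse ++ []).Perm
      ((pre ++ [j] ++ mid) ++ i :: post) := by
    refine List.perm_iff_count.2 fun x => ?_
    simp only [List.count_append, List.count_cons, List.count_reverse, List.count_nil]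
    ring
  have htransfer := sqrt_nsq_transfer_list_le hW ψ _ _ _ (perm₁.nodup_iff.2 hnd)
    (perm₁.length_eq.trans hlen)
  have hcommute := sqrt_nsq_commute_list_le hW ψ _ _ _ _ (perm₂.nodup_iff.2 hnd)
    (perm₂.length_eq.trans hlen)
  rw [← hdesc, List.nil_append] at htransfer
  rw [← hdesc] at perm₅
  have hnd_s : (pre ++ [j] ++ mid).Nodup := hnd.of_append_left
  rw [← List.sum_toFinset _ hnd_s, hIio] at htransfer
  rw [← List.sum_toFinset _ hnd_s.of_append_right, hIoo, Finset.sum_add_distrib,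
    Finset.sum_const, Fin.card_Ioo, nsmul_eq_mul] at hcommute
  have hdist := sqrt_nsq_sub_le (measured W ψ (List.finRange n).reverse [])
    (measured W ψ (post.reverse ++ [i]) (pre ++ [j] ++ mid))
    (measured W ψ (post.reverse ++ mid.reverse ++ [i]) (pre ++ [j]))
  have hmain := (sum_sum_abs_marginal_sub_le (fun f : Fin n → A => f i) (fun f => f j)
    _ _).trans (sum_abs_nsq_sub_le _ _
      ((nsq_measured hW ψ (perm₅.nodup_iff.2 hnd) (perm₅.length_eq.trans hlen)).trans hunit)
      ((nsq_measured hW ψ (perm₄.nodup_iff.2 hnd) (perm₄.length_eq.trans hlen)).trans hunit))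
  simp only [sum_ite_nsq_measured hW ψ (perm₃.nodup_iff.2 hnd)
    (perm₃.length_eq.trans hlen)] at hmain
  have hcast : (((i : ℕ) - (j : ℕ) - 1 : ℕ) : ℝ) ≤ (((i : ℕ) - (j : ℕ) + 1 : ℕ) : ℝ) := by
    exact_mod_cast (by omega)
  have hmul := mul_le_mul_of_nonneg_right hcast
    (show 0 ≤ transferErr ψ (W i) from Real.sqrt_nonneg _)
  have hflip : √(∑ b, nsq (((1 : Matrix (Fin d) (Fin d) ℂ) ⊗ₖ W i b
      - W i b ⊗ₖ (1 : Matrix (Fin d) (Fin d) ℂ)).mulVec ψ)) = transferErr ψ (W i) := by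
    simp only [transferErr, Matrix.sub_mulVec, nsq_sub_comm (Matrix.mulVec (1 ⊗ₖ _) ψ)]
  rw [hflip]
  change _ ≤ 2 * (∑ i' ∈ Finset.Iio i, transferErr ψ (W i')) + _ +
    2 * (∑ i' ∈ Finset.Ioo j i, exchangeErr ψ (W i) (W i'))
  refine hmain.trans ?_
  linarith
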